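/- If G is a subgroup of the symmetric group S_d that contains a d-cycle, a (d-1)-cycle, and an element σ whose cycle decomposition has a unique longest cycle whose length is a prime p with p < d - 2, then G = S_d. -/

import Mathlib

open Equiv Equiv.Perm MulAction

section Jordan

variable {α : Type*} [DecidableEq α]

/-- The elements of `G` supported in the finite set `s`. -/
def Subgroup.supportedIn (G : Subgroup (Perm α)) (s : Finset α) : Subgroup (Perm α) :=
  G ⊓ (Perm.ofSubtype : Perm {x // x ∈ s} →* Perm α).range

lemma Subgroup.mem_supportedIn {G : Subgroup (Perm α)} {s : Finset α} {g : Perm α} :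
    g ∈ G.supportedIn s ↔ g ∈ G ∧ ∀ x ∉ s, g x = x := by
  refine and_congr_right fun _ => ⟨?_, fun h => ?_⟩
  · rintro ⟨f, rfl⟩ x hx
    exact Perm.ofSubtype_apply_of_not_mem f hx
  · have hs : ∀ x, g x ≠ x → x ∈ s := fun x hx => by_contra fun hxs => hx (h x hxs)
    have hs' : ∀ x, g x ∈ s ↔ x ∈ s := by
      intro x
      by_cases hx : g x = x
      · rw [hx]
      · exact ⟨fun _ => hs x hx, fun _ => hs _ fun h => hx (g.injective h)⟩
    exact ⟨g.subtypePerm hs', Perm.ofSubtype_subtypePerm hs' hs⟩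

variable [Fintype α]

/-- A permutation commuting with a cycle agrees with a power of it on its support. -/
lemma Equiv.Perm.IsCycle.exists_zpow_apply_eq_of_commute {c z : Perm α} (hc : c.IsCycle)
    (hz : Commute z c) : ∃ n : ℤ, ∀ y ∈ c.support, z y = (c ^ n) y := by
  obtain ⟨x, hx, hxc⟩ := hc
  have hzx : c (z x) ≠ z x := by
    rw [← Perm.mul_apply, ← hz.eq, Perm.mul_apply]
    exact fun h => hx (z.injective h)
  obtain ⟨n, hn⟩ := hxc hzx
  refine ⟨n, fun y hy => ?_⟩
  obtain ⟨m, rfl⟩ := hxc (Perm.mem_support.mp hy)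
  rw [← Perm.mul_apply, (hz.zpow_right m).eq, Perm.mul_apply, ← hn, ← Perm.mul_apply,
    ← Perm.mul_apply, ← zpow_add, ← zpow_add, add_comm]

lemma Subgroup.card_supportedIn_dvd (G : Subgroup (Perm α)) (s : Finset α) :
    Nat.card (G.supportedIn s) ∣ s.card.factorial := by
  have h : Nat.card (Perm.ofSubtype : Perm {x // x ∈ s} →* Perm α).range =
      s.card.factorial := by
    rw [← Nat.card_congr (MonoidHom.ofInjective Perm.ofSubtype_injective).toEquiv,
      Nat.card_perm, Nat.card_eq_fintype_card, Fintype.card_coe]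
  exact h ▸ Subgroup.card_dvd_of_le inf_le_right

/-- Two elements of prime order `p` of a finite group whose order is not divisible by `p ^ 2`
generate conjugate subgroups. -/
lemma exists_conj_eq_zpow_of_orderOf_eq_prime {H : Type*} [Group H] [Finite H] {p : ℕ}
    (hp : p.Prime) (hH : ¬ p ^ 2 ∣ Nat.card H) {a b : H} (ha : orderOf a = p)
    (hb : orderOf b = p) : ∃ h : H, ∃ n : ℤ, h * a * h⁻¹ = b ^ n := by
  have : Fact p.Prime := ⟨hp⟩
  have hfac : (Nat.card H).factorization p = 1 := by
    have hne : Nat.card H ≠ 0 := Nat.card_pos.ne'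
    apply le_antisymm
    · by_contra! h
      exact hH ((hp.pow_dvd_iff_le_factorization hne).mpr h)
    · exact (hp.dvd_iff_one_le_factorization hne).mp (ha ▸ orderOf_dvd_natCard a)
  have hcard : ∀ g : H, orderOf g = p →
      Nat.card (Subgroup.zpowers g) = p ^ (Nat.card H).factorization p := by
    intro g hg
    rw [Nat.card_zpowers, hg, hfac, pow_one]
  obtain ⟨h, hh⟩ := MulAction.exists_smul_eq H (Sylow.ofCard _ (hcard a ha))
    (Sylow.ofCard _ (hcard b hb))
  have hmem : h * a * h⁻¹ ∈ (h • Sylow.ofCard _ (hcard a ha) : Sylow p H) := by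
    change h * a * h⁻¹ ∈ (h • Sylow.ofCard _ (hcard a ha) : Sylow p H).toSubgroup
    rw [Sylow.coe_subgroup_smul]
    exact Subgroup.smul_mem_pointwise_smul a (MulAut.conj h) _ (Subgroup.mem_zpowers a)
  rw [hh] at hmem
  obtain ⟨n, hn⟩ := Subgroup.mem_zpowers_iff.mp (show h * a * h⁻¹ ∈ Subgroup.zpowers b from hmem)
  exact ⟨h, n, hn.symm⟩

/-- If `G` is sufficiently transitive and contains a cycle `c` of prime length, then every
permutation of the fixed points of `c` is induced by an element of `G` normalizing `⟨c⟩`. -/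
lemma exists_mem_normalizing_of_isMultiplyPretransitive {G : Subgroup (Perm α)} {c : Perm α}
    (hc : c.IsCycle) (hp : c.support.card.Prime) (hcG : c ∈ G)
    (hG : IsMultiplyPretransitive G α (c.supportᶜ).card) {π : Perm α}
    (hπ : ∀ x ∈ c.support, π x = x) :
    ∃ g ∈ G, (∀ x ∉ c.support, g x = π x) ∧ ∃ n : ℤ, g * c * g⁻¹ = c ^ n := by
  have hπs : ∀ x, π x ∈ c.support ↔ x ∈ c.support := by
    intro x
    refine ⟨fun h => ?_, fun h => (hπ x h).symm ▸ h⟩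
    rwa [← π.injective (hπ _ h)]
  obtain ⟨g, hg⟩ : ∃ g ∈ G, ∀ x ∉ c.support, g x = π x := by
    let e : Fin (c.supportᶜ).card ↪ α :=
      (c.supportᶜ).equivFin.symm.toEmbedding.trans (Function.Embedding.subtype _)
    obtain ⟨g, hg⟩ := MulAction.exists_smul_eq G e (e.trans π.toEmbedding)
    refine ⟨g, g.2, fun x hx => ?_⟩
    have := DFunLike.congr_fun hg ((c.supportᶜ).equivFin ⟨x, by simpa using hx⟩)
    simpa [e, Subgroup.smul_def] using this
  obtain ⟨hgG, hgπ⟩ := hg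
  have hc' : c ∈ G.supportedIn c.support :=
    Subgroup.mem_supportedIn.mpr ⟨hcG, fun x hx => Perm.notMem_support.mp hx⟩
  have hgc : g * c * g⁻¹ ∈ G.supportedIn c.support := by
    refine Subgroup.mem_supportedIn.mpr
      ⟨G.mul_mem (G.mul_mem hgG hcG) (G.inv_mem hgG), fun x hx => ?_⟩
    have hinv : π (π⁻¹ x) = x := π.apply_symm_apply x
    have hy : π⁻¹ x ∉ c.support := by rwa [← hπs, hinv]
    have hx' : g⁻¹ x = π⁻¹ x := by
      rw [Perm.inv_eq_iff_eq, hgπ _ hy, hinv]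
    rw [Perm.mul_apply, Perm.mul_apply, hx', Perm.notMem_support.mp hy, hgπ _ hy, hinv]
  have hsq : ¬ c.support.card ^ 2 ∣ Nat.card (G.supportedIn c.support) := by
    intro h
    have h2 := h.trans (G.card_supportedIn_dvd c.support)
    obtain ⟨m, hm⟩ := Nat.exists_eq_succ_of_ne_zero hp.ne_zero
    rw [hm, Nat.factorial_succ, sq] at h2
    have h3 := Nat.dvd_of_mul_dvd_mul_left (Nat.succ_pos m) h2
    rw [hm] at hp
    have := hp.dvd_factorial.mp h3
    omega
  obtain ⟨h, n, hn⟩ := exists_conj_eq_zpow_of_orderOf_eq_prime hp hsq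
    (a := ⟨g * c * g⁻¹, hgc⟩) (b := ⟨c, hc'⟩)
    (by rw [Subgroup.orderOf_mk, ← MulAut.conj_apply, MulEquiv.orderOf_eq, hc.orderOf])
    (by rw [Subgroup.orderOf_mk, hc.orderOf])
  obtain ⟨hhG, hhfix⟩ := Subgroup.mem_supportedIn.mp h.2
  refine ⟨h * g, G.mul_mem hhG hgG, fun x hx => ?_, n, ?_⟩
  · rw [Perm.mul_apply, hgπ x hx, hhfix _ (by rwa [hπs])]
  · have := congrArg Subtype.val hn
    simpa [mul_assoc] using this

lemma commute_commutator_of_conj_eq_zpow {H : Type*} [Group H] {x y c : H} {m n : ℤ}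
    (hx : x * c * x⁻¹ = c ^ m) (hy : y * c * y⁻¹ = c ^ n) :
    Commute ((y * x)⁻¹ * (x * y)) c := by
  have hxy : (x * y) * c * (x * y)⁻¹ = c ^ (m * n) := by
    rw [show (x * y) * c * (x * y)⁻¹ = x * (y * c * y⁻¹) * x⁻¹ by group, hy, ← conj_zpow, hx,
      zpow_mul]
  have hyx : (y * x) * c * (y * x)⁻¹ = c ^ (m * n) := by
    rw [show (y * x) * c * (y * x)⁻¹ = y * (x * c * x⁻¹) * y⁻¹ by group, hx, ← conj_zpow, hy,
      ← zpow_mul, mul_comm]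
  have h : (x * y) * c = (y * x) * c * (y * x)⁻¹ * (x * y) := by
    rw [hyx, ← hxy, inv_mul_cancel_right]
  rw [Commute, SemiconjBy, mul_assoc, h]
  group

/-- **Jordan's theorem**: a primitive permutation group containing a cycle of prime length with at
least three fixed points contains the alternating group. -/
theorem alternatingGroup_le_of_isPreprimitive_of_isCycle_prime {G : Subgroup (Perm α)}
    (hG : IsPreprimitive G α) {c : Perm α} (hc : c.IsCycle) (hp : c.support.card.Prime)
    (hcard : c.support.card + 3 ≤ Fintype.card α) (hcG : c ∈ G) : alternatingGroup α ≤ G := by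
  have hadd := c.support.card_add_card_compl
  obtain ⟨n, hn⟩ : ∃ n, (c.supportᶜ).card = n + 1 :=
    Nat.exists_eq_succ_of_ne_zero (by omega)
  have hlt : n + 2 < Nat.card α := by
    have := hp.two_le
    rw [Nat.card_eq_fintype_card]
    omega
  have htrans : IsMultiplyPretransitive G α (c.supportᶜ).card := by
    have hpre := isPretransitive_of_isCycle_mem hc hcG
    have hprim : IsPreprimitive (fixingSubgroup G (c.support : Set α)ᶜ)
        (SubMulAction.ofFixingSubgroup G (c.support : Set α)ᶜ) := by
      apply IsPreprimitive.of_prime_card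
      rwa [show Nat.card (SubMulAction.ofFixingSubgroup G (c.support : Set α)ᶜ) =
        c.support.card from ?_]
      rw [← Fintype.card_coe, ← Nat.card_eq_fintype_card]
      refine Nat.card_congr (Equiv.subtypeEquivRight fun x => ?_)
      simp [SubMulAction.mem_ofFixingSubgroup_iff]
    have := (hG.isMultiplyPreprimitive (s := (c.support : Set α)ᶜ) (n := n)
      (by rw [← Finset.coe_compl, Set.ncard_coe_finset, hn]) hlt hprim).isMultiplyPretransitive
    rw [hn]
    exact isMultiplyPretransitive_of_le (n := n + 2) (by omega) hlt.le
  obtain ⟨a, b, e, ha, hb, he, hab, hae, hbe⟩ :=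
    Finset.two_lt_card_iff.mp (show 2 < (c.supportᶜ).card by omega)
  rw [Finset.mem_compl] at ha hb he
  have hfix : ∀ u v, u ∉ c.support → v ∉ c.support → ∀ x ∈ c.support, swap u v x = x :=
    fun u v hu hv x hx => swap_apply_of_ne_of_ne (fun h => hu (h ▸ hx)) (fun h => hv (h ▸ hx))
  have hstab : ∀ u v, u ∉ c.support → v ∉ c.support → ∀ x ∉ c.support,
      swap u v x ∉ c.support := by
    intro u v hu hv x hx
    rw [swap_apply_def]
    split_ifs <;> assumption
  obtain ⟨x, hxG, hx, m, hxc⟩ :=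
    exists_mem_normalizing_of_isMultiplyPretransitive hc hp hcG htrans (hfix a b ha hb)
  obtain ⟨y, hyG, hy, k, hyc⟩ :=
    exists_mem_normalizing_of_isMultiplyPretransitive hc hp hcG htrans (hfix a e ha he)
  obtain ⟨l, hl⟩ := hc.exists_zpow_apply_eq_of_commute (commute_commutator_of_conj_eq_zpow hxc hyc)
  have hthree := (isThreeCycle_swap_mul_swap_same hab hae hbe).isThreeCycle_sq
  refine alternatingGroup_le_of_isPreprimitive_of_isThreeCycle_mem hG hthree ?_
  suffices h : swap a b * swap a e * (swap a b * swap a e) =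
      (y * x)⁻¹ * (x * y) * (c ^ l)⁻¹ by
    rw [h]
    exact G.mul_mem (G.mul_mem (G.inv_mem (G.mul_mem hyG hxG)) (G.mul_mem hxG hyG))
      (G.inv_mem (G.zpow_mem hcG l))
  ext1 z
  by_cases hz : z ∈ c.support
  · have hz' : (c ^ l)⁻¹ z ∈ c.support := by
      rw [← zpow_neg]
      exact Perm.zpow_apply_mem_support.mpr hz
    have hinv : (c ^ l) ((c ^ l)⁻¹ z) = z := (c ^ l).apply_symm_apply z
    rw [Perm.mul_apply _ (c ^ l)⁻¹, hl _ hz', hinv]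
    simp only [Perm.mul_apply, hfix a b ha hb z hz, hfix a e ha he z hz]
  · have hcz : (c ^ l)⁻¹ z = z := by
      rw [← zpow_neg]
      exact Perm.zpow_apply_eq_self_of_apply_eq_self (Perm.notMem_support.mp hz) _
    have h1 := hstab a e ha he z hz
    have h2 := hstab a b ha hb _ h1
    have h3 := hstab a e ha he _ h2
    rw [Perm.mul_apply _ (c ^ l)⁻¹, hcz, Perm.mul_apply (y * x)⁻¹, eq_comm, Perm.inv_eq_iff_eq]
    simp only [Perm.mul_apply]
    rw [hy z hz, hx _ h1, hx _ (hstab a b ha hb _ h3), swap_apply_self, hy _ h3, swap_apply_self]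

end Jordan

/-- A group containing a full cycle and a cycle fixing exactly one point is primitive. -/
lemma isPreprimitive_of_isCycle_of_isCycle {α : Type*} [Fintype α] [DecidableEq α]
    {G : Subgroup (Perm α)} {g₁ g₂ : Perm α} (hg₁ : g₁ ∈ G) (hc₁ : g₁.IsCycle)
    (hs₁ : g₁.support.card = Fintype.card α) (hg₂ : g₂ ∈ G) (hc₂ : g₂.IsCycle)
    (hs₂ : g₂.support.card + 1 = Fintype.card α) : IsPreprimitive G α := by
  have htrans : IsPretransitive G α := by
    have huniv := Finset.card_eq_iff_eq_univ _ |>.mp hs₁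
    have hmove : ∀ x, g₁ x ≠ x := fun x => Perm.mem_support.mp (huniv ▸ Finset.mem_univ x)
    refine ⟨fun x y => ?_⟩
    obtain ⟨n, hn⟩ := hc₁.exists_zpow_eq (hmove x) (hmove y)
    exact ⟨⟨g₁ ^ n, G.zpow_mem hg₁ n⟩, hn⟩
  obtain ⟨a, ha⟩ : ∃ a, g₂.supportᶜ = {a} :=
    Finset.card_eq_one.mp (by have := g₂.support.card_add_card_compl; omega)
  have hmem : ∀ x, g₂ x = x ↔ x = a := by
    intro x
    rw [← Perm.notMem_support, ← Finset.mem_compl, ha, Finset.mem_singleton]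
  apply isPreprimitive_of_is_two_pretransitive
  rw [SubMulAction.ofStabilizer.isMultiplyPretransitive (a := a), is_one_pretransitive_iff]
  refine ⟨fun ⟨x, hx⟩ ⟨y, hy⟩ => ?_⟩
  rw [SubMulAction.mem_ofStabilizer_iff] at hx hy
  obtain ⟨n, hn⟩ := hc₂.exists_zpow_eq (mt (hmem x).mp hx) (mt (hmem y).mp hy)
  exact ⟨⟨⟨g₂ ^ n, G.zpow_mem hg₂ n⟩,
    Perm.zpow_apply_eq_self_of_apply_eq_self ((hmem a).mpr rfl) n⟩, Subtype.ext hn⟩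

/-- If the cycle type of `σ` has a unique longest cycle, of prime length `p`, then some power of
`σ` is a cycle of length `p`. -/
lemma exists_pow_isCycle_of_count_eq_one {α : Type*} [Fintype α] [DecidableEq α] {σ : Perm α}
    {p : ℕ} (hp : p.Prime) (huniq : σ.cycleType.count p = 1) (hmax : ∀ q ∈ σ.cycleType, q ≤ p) :
    ∃ n : ℕ, (σ ^ n).IsCycle ∧ (σ ^ n).support.card = p := by
  obtain ⟨c, τ, rfl, hd, hc, hcp⟩ := Perm.mem_cycleType_iff.mp
    (Multiset.count_pos.mp (huniq ▸ one_pos))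
  rw [hd.cycleType_mul, hc.cycleType, hcp] at huniq hmax
  have hnot : p ∉ τ.cycleType := by
    rw [Multiset.count_add, Multiset.count_singleton_self] at huniq
    exact Multiset.count_eq_zero.mp (by omega)
  have hτ : τ ^ (p - 1).factorial = 1 := by
    rw [← orderOf_dvd_iff_pow_eq_one, ← Perm.lcm_cycleType, Multiset.lcm_dvd]
    intro q hq
    have hle := hmax q (Multiset.mem_add.mpr (Or.inr hq))
    have hne : q ≠ p := fun h => hnot (h ▸ hq)
    have := Perm.two_le_of_mem_cycleType hq
    exact Nat.dvd_factorial (by omega) (by omega)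
  have hcop : ((p - 1).factorial).Coprime (orderOf c) := by
    rw [hc.orderOf, hcp, Nat.coprime_comm, hp.coprime_iff_not_dvd, hp.dvd_factorial]
    have := hp.pos
    omega
  refine ⟨(p - 1).factorial, ?_⟩
  rw [hd.commute.mul_pow, hτ, mul_one, Perm.support_pow_coprime hcop]
  exact ⟨hc.pow_iff.mpr hcop, hcp⟩

/-- If a subgroup `G` of the symmetric group `S_d` contains a `d`-cycle, a `(d-1)`-cycle,
and an element `σ` whose cycle decomposition has a unique longest cycle, whose length is a
prime `p` with `p < d - 2`, then `G = S_d`. -/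
theorem stmt0 (d : ℕ) (G : Subgroup (Equiv.Perm (Fin d)))
    (g₁ : Equiv.Perm (Fin d)) (hg₁ : g₁ ∈ G) (hc₁ : g₁.IsCycle)
    (hs₁ : g₁.support.card = d)
    (g₂ : Equiv.Perm (Fin d)) (hg₂ : g₂ ∈ G) (hc₂ : g₂.IsCycle)
    (hs₂ : g₂.support.card = d - 1)
    (σ : Equiv.Perm (Fin d)) (hσ : σ ∈ G)
    (p : ℕ) (hp : p.Prime) (hpd : p < d - 2)
    (hmem : p ∈ σ.cycleType) (huniq : σ.cycleType.count p = 1)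
    (hmax : ∀ q ∈ σ.cycleType, q ≤ p) :
    G = ⊤ := by
  have hG : IsPreprimitive G (Fin d) :=
    isPreprimitive_of_isCycle_of_isCycle hg₁ hc₁ (by simpa using hs₁) hg₂ hc₂
      (by rw [Fintype.card_fin]; omega)
  obtain ⟨n, hcyc, hcard⟩ := exists_pow_isCycle_of_count_eq_one hp huniq hmax
  have hle : alternatingGroup (Fin d) ≤ G :=
    alternatingGroup_le_of_isPreprimitive_of_isCycle_prime hG hcyc (hcard ▸ hp)
      (by rw [hcard, Fintype.card_fin]; omega) (G.pow_mem hσ n)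
  obtain ⟨g, hg, hodd⟩ : ∃ g ∈ G, Perm.sign g = -1 := by
    by_contra! h
    have h₁ := (Int.units_eq_one_or (Perm.sign g₁)).resolve_right (h g₁ hg₁)
    have h₂ := (Int.units_eq_one_or (Perm.sign g₂)).resolve_right (h g₂ hg₂)
    obtain ⟨m, rfl⟩ : ∃ m, d = m + 1 := ⟨d - 1, by omega⟩
    rw [hc₁.sign, hs₁, pow_succ] at h₁
    rw [hc₂.sign, hs₂, Nat.add_sub_cancel] at h₂
    rw [neg_eq_iff_eq_neg] at h₁ h₂
    rw [h₂] at h₁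
    exact absurd h₁ (by decide)
  rw [eq_top_iff]
  intro τ _
  rcases Int.units_eq_one_or (Perm.sign τ) with h | h
  · exact hle (Perm.mem_alternatingGroup.mpr h)
  · have : τ * g ∈ G := hle (Perm.mem_alternatingGroup.mpr (by rw [Perm.sign_mul, h, hodd]; rfl))
    exact (G.mul_mem_cancel_right hg).mp this
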